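/- arXiv:1510.02964 — 4 statements merged into one kernel-verified Lean document; each statement's English description precedes it below -/
import Mathlib

section
/- Let A⁰, A¹, A² be vector spaces over ℂ, let d₀ : A⁰ → A¹ and d₁ : A¹ → A² be linear maps with d₁ ∘ d₀ = 0. Let n ≥ 1, and for each i = 1, …, n let Vᵢ : A⁰ → A¹ and Wᵢ : A¹ → A² be linear maps; set Vᵢ = 0 and Wᵢ = 0 for i > n. Assume that for every k ≥ 1 one has d₁ ∘ V_k + W_k ∘ d₀ + Σ_{i+j=k, i≥1, j≥1} Wᵢ ∘ V_j = 0. Suppose f₀, …, f_n ∈ A⁰ satisfy d₀ f_k + Σ_{i=1}^{k} Vᵢ(f_{k−i}) = 0 for every k = 0, …, n. Put y = Σ_{i=1}^{n} Vᵢ(f_{n+1−i}) and y₁ = Σ_{i=2}^{n} Vᵢ(f_{n+2−i}). Then d₁(y) = 0 and W₁(y) + d₁(y₁) = 0; in particular W₁(y) lies in the range of d₁. -/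
/-- A sum over an antidiagonal, with the term of first index zero split off. -/
theorem Finset.Nat.sum_antidiagonal_eq_add_sum_Icc {M : Type*} [AddCommMonoid M]
    (F : ℕ → ℕ → M) (k : ℕ) :
    ∑ p ∈ Finset.HasAntidiagonal.antidiagonal k, F p.1 p.2 = F 0 k + ∑ i ∈ Finset.Icc 1 k, F i (k - i) := by
  rw [Finset.Nat.sum_antidiagonal_eq_sum_range_succ F, Finset.range_eq_Ico,
    Finset.sum_eq_sum_Ico_succ_bot k.succ_pos, Nat.sub_zero]
  rfl

/-- If the Cauchy product of two sequences of linear maps vanishes, then applying them in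
succession, by Cauchy products, to any sequence of vectors gives zero. -/
theorem LinearMap.sum_antidiagonal_sum_antidiagonal_eq_zero {R A B C : Type*} [Semiring R]
    [AddCommMonoid A] [AddCommMonoid B] [AddCommMonoid C] [Module R A] [Module R B] [Module R C]
    (V : ℕ → (A →ₗ[R] B)) (W : ℕ → (B →ₗ[R] C))
    (h : ∀ k, ∑ p ∈ Finset.HasAntidiagonal.antidiagonal k, W p.1 ∘ₗ V p.2 = 0) (g : ℕ → A) (N : ℕ) :
    ∑ p ∈ Finset.HasAntidiagonal.antidiagonal N, W p.1 (∑ q ∈ Finset.HasAntidiagonal.antidiagonal p.2, V q.1 (g q.2)) = 0 := by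
  have assoc : ∑ p ∈ Finset.HasAntidiagonal.antidiagonal N,
      ∑ q ∈ Finset.HasAntidiagonal.antidiagonal p.2, W p.1 (V q.1 (g q.2)) =
      ∑ p ∈ Finset.HasAntidiagonal.antidiagonal N,
        ∑ q ∈ Finset.HasAntidiagonal.antidiagonal p.1, W q.1 (V q.2 (g p.2)) := by
    simp only [Finset.sum_sigma']
    apply Finset.sum_nbij' (fun ⟨⟨i, _⟩, ⟨k, l⟩⟩ ↦ ⟨(i + k, l), (i, k)⟩)
      (fun ⟨⟨_, j⟩, ⟨k, l⟩⟩ ↦ ⟨(k, l + j), (l, j)⟩) <;> simp_all <;> grind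
  simp only [map_sum]
  rw [assoc]
  refine Finset.sum_eq_zero fun p _ => ?_
  simpa using LinearMap.congr_fun (h p.1) (g p.2)

/-- Lemma 2.5 of the paper, algebraic form.
Given a two-step complex `d₀ : A⁰ → A¹`, `d₁ : A¹ → A²` with `d₁ ∘ d₀ = 0`,
operators `Vᵢ, Wᵢ` vanishing for `i > n` (and indexed from 1) satisfying the
integrability identities, and `f₀, …, f_n` solving the deformation equation up
to order `n`, then `y = Σ_{i=1}^n Vᵢ(f_{n+1-i})` satisfies `d₁ y = 0` and
`W₁ y + d₁ y₁ = 0` with `y₁ = Σ_{i=2}^n Vᵢ(f_{n+2-i})`; in particular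
`W₁ y ∈ range d₁`. -/
theorem statement0
    {A0 A1 A2 : Type*}
    [AddCommGroup A0] [AddCommGroup A1] [AddCommGroup A2]
    [Module ℂ A0] [Module ℂ A1] [Module ℂ A2]
    (d0 : A0 →ₗ[ℂ] A1) (d1 : A1 →ₗ[ℂ] A2)
    (hd : d1 ∘ₗ d0 = 0)
    (n : ℕ) (hn : 1 ≤ n)
    (V : ℕ → (A0 →ₗ[ℂ] A1)) (W : ℕ → (A1 →ₗ[ℂ] A2))
    (hV : ∀ i, n < i → V i = 0) (hW : ∀ i, n < i → W i = 0)
    (hint : ∀ k, 1 ≤ k →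
      d1 ∘ₗ V k + W k ∘ₗ d0 + ∑ i ∈ Finset.Icc 1 (k - 1), (W i ∘ₗ V (k - i)) = 0)
    (f : ℕ → A0)
    (hf : ∀ k, k ≤ n → d0 (f k) + ∑ i ∈ Finset.Icc 1 k, V i (f (k - i)) = 0)
    (y y1 : A1)
    (hy : y = ∑ i ∈ Finset.Icc 1 n, V i (f (n + 1 - i)))
    (hy1 : y1 = ∑ i ∈ Finset.Icc 2 n, V i (f (n + 2 - i))) :
    d1 y = 0 ∧ W 1 y + d1 y1 = 0 ∧ W 1 y ∈ LinearMap.range d1 := by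
  let V' : ℕ → (A0 →ₗ[ℂ] A1) := fun i => if i = 0 then d0 else V i
  let W' : ℕ → (A1 →ₗ[ℂ] A2) := fun i => if i = 0 then d1 else W i
  let g : ℕ → A0 := fun i => if i ≤ n then f i else 0
  let u : ℕ → A1 := fun m => ∑ q ∈ Finset.HasAntidiagonal.antidiagonal m, V' q.1 (g q.2)
  have hV' : ∀ i, 1 ≤ i → V' i = V i := fun i hi => if_neg (by lia)
  have hW' : ∀ i, 1 ≤ i → W' i = W i := fun i hi => if_neg (by lia)
  have hg : ∀ i, i ≤ n → g i = f i := fun i hi => if_pos hi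
  have hg0 : ∀ i, n < i → g i = 0 := fun i hi => if_neg (by lia)
  have hu : ∀ m, u m = d0 (g m) + ∑ i ∈ Finset.Icc 1 m, V i (g (m - i)) := by
    intro m
    refine (Finset.Nat.sum_antidiagonal_eq_add_sum_Icc (fun i j => V' i (g j)) m).trans ?_
    refine congrArg₂ _ rfl (Finset.sum_congr rfl fun i hi => ?_)
    rw [hV' i (Finset.mem_Icc.1 hi).1]
  have hWV : ∀ k, ∑ p ∈ Finset.HasAntidiagonal.antidiagonal k, W' p.1 ∘ₗ V' p.2 = 0 := by
    intro k
    rcases k with _ | k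
    · simpa [V', W'] using hd
    · rw [Finset.Nat.sum_antidiagonal_eq_add_sum_Icc (fun i j => W' i ∘ₗ V' j),
        Finset.sum_Icc_succ_top (by lia), ← hint (k + 1) (by lia), add_assoc,
        add_comm (W (k + 1) ∘ₗ d0), Nat.add_sub_cancel, Nat.sub_self,
        hV' _ (by lia), hW' (k + 1) (by lia)]
      refine congrArg₂ _ rfl (congrArg₂ _ (Finset.sum_congr rfl fun i hi => ?_) rfl)
      rw [Finset.mem_Icc] at hi
      rw [hV' _ (by lia), hW' _ hi.1]
  have hu0 : ∀ m, m ≤ n → u m = 0 := by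
    intro m hm
    rw [hu, ← hf m hm, hg m hm]
    refine congrArg₂ _ rfl (Finset.sum_congr rfl fun i _ => ?_)
    rw [hg _ (by lia)]
  have hu1 : u (n + 1) = y := by
    rw [hu, hy, hg0 _ (by lia), map_zero, zero_add, Finset.sum_Icc_succ_top (by lia),
      hV _ (by lia), LinearMap.zero_apply, add_zero]
    refine Finset.sum_congr rfl fun i hi => ?_
    rw [Finset.mem_Icc] at hi
    rw [hg _ (by lia)]
  have hu2 : u (n + 2) = y1 := by
    rw [hu, hy1, hg0 _ (by lia), map_zero, zero_add]
    symm
    have hsub : Finset.Icc 2 n ⊆ Finset.Icc 1 (n + 2) :=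
      Finset.Icc_subset_Icc (by lia) (by lia)
    refine Finset.sum_subset_zero_on_sdiff hsub (fun i hi => ?_) fun i hi => ?_
    · simp only [Finset.mem_sdiff, Finset.mem_Icc] at hi
      by_cases h : n < i
      · rw [hV i h, LinearMap.zero_apply]
      · rw [hg0 _ (by lia), map_zero]
    · rw [Finset.mem_Icc] at hi
      rw [hg _ (by lia)]
  have key : ∀ N, d1 (u N) + ∑ i ∈ Finset.Icc 1 N, W' i (u (N - i)) = 0 := fun N =>
    (Finset.Nat.sum_antidiagonal_eq_add_sum_Icc (fun i j => W' i (u j)) N).symm.trans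
      (LinearMap.sum_antidiagonal_sum_antidiagonal_eq_zero V' W' hWV g N)
  have hy_closed : d1 y = 0 := by
    have h := key (n + 1)
    rwa [hu1, Finset.sum_eq_zero, add_zero] at h
    intro i hi
    rw [Finset.mem_Icc] at hi
    rw [hu0 _ (by lia), map_zero]
  have hobs : W 1 y + d1 y1 = 0 := by
    have h := key (n + 2)
    rw [hu2, Finset.sum_eq_single_of_mem 1 (by simp), hW' 1 le_rfl] at h
    · rw [add_comm, ← hu1]
      exact h
    · intro i hi hi1
      rw [Finset.mem_Icc] at hi
      rw [hu0 _ (by lia), map_zero]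
  exact ⟨hy_closed, hobs, -y1, by rw [map_neg, eq_neg_of_add_eq_zero_left hobs]⟩
end

section
/- Let A⁰, A¹, A² be vector spaces over ℂ and d₀ : A⁰ → A¹, d₁ : A¹ → A² linear maps with d₁ ∘ d₀ = 0. Let B be a ℂ-vector space and μ₀ : B × A⁰ → A¹, μ₁ : B × A¹ → A² bilinear maps satisfying: (i) d₁(μ₀(v, f)) + μ₁(v, d₀ f) = 0 for all v ∈ B and f ∈ A⁰; (ii) μ₁(v, μ₀(w, f)) + μ₁(w, μ₀(v, f)) = 0 for all v, w ∈ B and f ∈ A⁰. Let f₀ ∈ A⁰ with d₀ f₀ = 0 and v₁ ∈ B with μ₀(v₁, f₀) ∈ range(d₀). Assume the transversality condition: for every y ∈ A¹ with d₁ y = 0 and μ₁(v₁, y) ∈ range(d₁), there exist s ∈ A⁰ with d₀ s = 0, an element w ∈ B, and g ∈ A⁰ such that y = μ₀(w, f₀) + μ₀(v₁, s) + d₀ g. Then there exist a sequence (vᵢ)_{i ≥ 1} in B with v₁ the given element, and a sequence (fᵢ)_{i ≥ 0} in A⁰ with f₀ the given element, such that for every n ≥ 0: d₀ f_n + Σ_{i=1}^{n}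 μ₀(vᵢ, f_{n−i}) = 0. -/
/-- The coefficient of `tⁿ` in `(d + ∑_{i ≥ 1} tⁱ vᵢ) (∑_{i ≥ 0} tⁱ fᵢ)`. -/
def deformationCoeff {R A0 A1 B : Type*} [CommRing R]
    [AddCommGroup A0] [AddCommGroup A1] [AddCommGroup B] [Module R A0] [Module R A1] [Module R B]
    (d : A0 →ₗ[R] A1) (μ : B →ₗ[R] A0 →ₗ[R] A1) (v : ℕ → B) (f : ℕ → A0) (n : ℕ) : A1 :=
  d (f n) + ∑ i ∈ Finset.Icc 1 n, μ (v i) (f (n - i))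

section

variable {R A0 A1 A2 B : Type*} [CommRing R]
  [AddCommGroup A0] [AddCommGroup A1] [AddCommGroup A2] [AddCommGroup B]
  [Module R A0] [Module R A1] [Module R A2] [Module R B]

theorem deformationCoeff_congr (d : A0 →ₗ[R] A1) (μ : B →ₗ[R] A0 →ₗ[R] A1)
    {v v' : ℕ → B} {f f' : ℕ → A0} {n : ℕ}
    (hv : ∀ i ≤ n, v i = v' i) (hf : ∀ i ≤ n, f i = f' i) :
    deformationCoeff d μ v f n = deformationCoeff d μ v' f' n := by
  unfold deformationCoeff
  rw [hf n le_rfl]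
  congr 1
  refine Finset.sum_congr rfl fun i hi ↦ ?_
  rw [hv i (Finset.mem_Icc.1 hi).2, hf _ (Nat.sub_le n i)]

/-- Anticommuting operators satisfy `v(t) ∘ v(t) = 0`, coefficientwise. -/
theorem sum_sum_anticomm_eq_zero [IsAddTorsionFree A2]
    (μ0 : B →ₗ[R] A0 →ₗ[R] A1) (μ1 : B →ₗ[R] A1 →ₗ[R] A2)
    (hanti : ∀ (v w : B) (f : A0), μ1 v (μ0 w f) + μ1 w (μ0 v f) = 0)
    (v : ℕ → B) (f : ℕ → A0) (n : ℕ) :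
    ∑ i ∈ Finset.Icc 1 n, ∑ k ∈ Finset.Icc 1 (n - i), μ1 (v i) (μ0 (v k) (f (n - i - k))) = 0 := by
  rw [← self_eq_neg]
  calc
    _ = ∑ k ∈ Finset.Icc 1 n, ∑ i ∈ Finset.Icc 1 (n - k),
        μ1 (v i) (μ0 (v k) (f (n - i - k))) := by
      refine Finset.sum_comm' fun i k ↦ ?_
      simp only [Finset.mem_Icc]
      omega
    _ = _ := by
      simp only [← Finset.sum_neg_distrib]
      refine Finset.sum_congr rfl fun k _ ↦ Finset.sum_congr rfl fun i _ ↦ ?_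
      rw [Nat.sub_right_comm]
      exact eq_neg_of_add_eq_zero_left (hanti _ _ _)

/-- The square of `d + v(t)` vanishes, coefficientwise. -/
theorem map_deformationCoeff_add_sum [IsAddTorsionFree A2]
    (d0 : A0 →ₗ[R] A1) (d1 : A1 →ₗ[R] A2) (hd : d1 ∘ₗ d0 = 0)
    (μ0 : B →ₗ[R] A0 →ₗ[R] A1) (μ1 : B →ₗ[R] A1 →ₗ[R] A2)
    (hleib : ∀ (v : B) (f : A0), d1 (μ0 v f) + μ1 v (d0 f) = 0)
    (hanti : ∀ (v w : B) (f : A0), μ1 v (μ0 w f) + μ1 w (μ0 v f) = 0)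
    (v : ℕ → B) (f : ℕ → A0) (n : ℕ) :
    d1 (deformationCoeff d0 μ0 v f n) +
      ∑ i ∈ Finset.Icc 1 n, μ1 (v i) (deformationCoeff d0 μ0 v f (n - i)) = 0 := by
  have hdd : d1 (d0 (f n)) = 0 := LinearMap.congr_fun hd (f n)
  simp only [deformationCoeff, map_add, map_sum, hdd, zero_add, Finset.sum_add_distrib,
    sum_sum_anticomm_eq_zero μ0 μ1 hanti, add_zero]
  rw [← Finset.sum_add_distrib]
  exact Finset.sum_eq_zero fun i _ ↦ hleib _ _

/-- Correcting `v_{n+1}`, `f_n` and `f_{n+1}` changes the coefficient of `tⁿ⁺¹` linearly. -/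
theorem deformationCoeff_sub_single (d : A0 →ₗ[R] A1) (μ : B →ₗ[R] A0 →ₗ[R] A1)
    (v : ℕ → B) (f : ℕ → A0) {n : ℕ} (hn : 1 ≤ n) (w : B) (s g : A0) :
    deformationCoeff d μ (v - Pi.single (n + 1) w) (f - Pi.single n s - Pi.single (n + 1) g) (n + 1)
      = deformationCoeff d μ v f (n + 1) - (μ w (f 0) + μ (v 1) s + d g) := by
  have hterm : ∀ i ∈ Finset.Icc 1 (n + 1),
      μ ((v - Pi.single (n + 1) w : ℕ → B) i)
        ((f - Pi.single n s - Pi.single (n + 1) g : ℕ → A0) (n + 1 - i)) =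
      μ (v i) (f (n + 1 - i)) - (if i = n + 1 then μ w (f 0) else 0)
        - (if i = 1 then μ (v 1) s else 0) := by
    intro i hi
    rw [Finset.mem_Icc] at hi
    have h1 : n + 1 - i ≠ n + 1 := by omega
    by_cases hin : i = n + 1
    · subst hin
      have h2 : 0 ≠ n := by omega
      have h3 : n ≠ 0 := by omega
      simp [h2, h3]
    · by_cases hi1 : i = 1
      · subst hi1
        have h2 : n ≠ 0 := by omega
        simp [h2]
      · have h2 : n + 1 - i ≠ n := by omega
        simp [hin, hi1, h1, h2]
  unfold deformationCoeff
  rw [Finset.sum_congr rfl hterm]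
  simp only [Finset.sum_sub_distrib, Finset.sum_ite_eq', Finset.mem_Icc, Pi.sub_apply, map_sub,
    Pi.single_eq_same, le_refl, and_self, if_true, Nat.le_add_left,
    Pi.single_eq_of_ne (Nat.succ_ne_self n), map_zero]
  abel

/-- Under transversality a solution modulo `tⁿ⁺¹` extends to one modulo `tⁿ⁺²`, after a change of
the coefficient `f_n` alone. -/
theorem exists_deformation_extension [IsAddTorsionFree A2]
    (d0 : A0 →ₗ[R] A1) (d1 : A1 →ₗ[R] A2) (hd : d1 ∘ₗ d0 = 0)
    (μ0 : B →ₗ[R] A0 →ₗ[R] A1) (μ1 : B →ₗ[R] A1 →ₗ[R] A2)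
    (hleib : ∀ (v : B) (f : A0), d1 (μ0 v f) + μ1 v (d0 f) = 0)
    (hanti : ∀ (v w : B) (f : A0), μ1 v (μ0 w f) + μ1 w (μ0 v f) = 0)
    (v : ℕ → B) (f : ℕ → A0)
    (htrans : ∀ y : A1, d1 y = 0 → μ1 (v 1) y ∈ LinearMap.range d1 →
      ∃ (s : A0) (w : B) (g : A0), d0 s = 0 ∧ y = μ0 w (f 0) + μ0 (v 1) s + d0 g)
    {n : ℕ} (hn : 1 ≤ n) (h : ∀ k ≤ n, deformationCoeff d0 μ0 v f k = 0) :
    ∃ (v' : ℕ → B) (f' : ℕ → A0), (∀ i ≤ n, v' i = v i) ∧ (∀ i < n, f' i = f i) ∧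
      ∀ k ≤ n + 1, deformationCoeff d0 μ0 v' f' k = 0 := by
  have hclosed : d1 (deformationCoeff d0 μ0 v f (n + 1)) = 0 := by
    have key := map_deformationCoeff_add_sum d0 d1 hd μ0 μ1 hleib hanti v f (n + 1)
    rwa [Finset.sum_eq_zero, add_zero] at key
    intro i hi
    rw [Finset.mem_Icc] at hi
    rw [h _ (by omega), map_zero]
  have hexact : μ1 (v 1) (deformationCoeff d0 μ0 v f (n + 1)) ∈ LinearMap.range d1 := by
    have key := map_deformationCoeff_add_sum d0 d1 hd μ0 μ1 hleib hanti v f (n + 2)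
    rw [Finset.sum_eq_single_of_mem 1 (by simp)] at key
    · exact ⟨-deformationCoeff d0 μ0 v f (n + 2), by
        rw [map_neg]; exact (eq_neg_of_add_eq_zero_right key).symm⟩
    · intro i hi hi1
      rw [Finset.mem_Icc] at hi
      rw [h _ (by omega), map_zero]
  obtain ⟨s, w, g, hs, hy⟩ := htrans _ hclosed hexact
  have hv : ∀ i ≤ n, (v - Pi.single (n + 1) w : ℕ → B) i = v i := fun i hi ↦ by
    simp [Pi.single_eq_of_ne (show i ≠ n + 1 by omega)]
  have hf : ∀ i < n, (f - Pi.single n s - Pi.single (n + 1) g : ℕ → A0) i = f i := fun i hi ↦ by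
    simp [Pi.single_eq_of_ne (show i ≠ n + 1 by omega), Pi.single_eq_of_ne hi.ne]
  refine ⟨_, _, hv, hf, fun k hk ↦ ?_⟩
  rcases hk.eq_or_lt with rfl | hk
  · rw [deformationCoeff_sub_single d0 μ0 v f hn, ← hy, sub_self]
  rcases (Nat.lt_succ_iff.1 hk).eq_or_lt with rfl | hk
  · rw [← h k le_rfl]
    unfold deformationCoeff
    congr 1
    · simp [hs]
    · refine Finset.sum_congr rfl fun i hi ↦ ?_
      rw [Finset.mem_Icc] at hi
      rw [hv i hi.2, hf _ (by omega)]
  · rw [← h k hk.le]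
    exact deformationCoeff_congr d0 μ0 (fun i hi ↦ hv i (by omega)) fun i hi ↦ hf i (by omega)

end

/-- formal content of Proposition 1.1, Transversality.
Under the cochain-level transversality hypothesis, a pair `(v₁, f₀)` with
`d₀ f₀ = 0` and `μ₀(v₁, f₀) ∈ range d₀` admits a formal solution of the
deformation equation: sequences `(vᵢ)` and `(fᵢ)` with
`d₀ f_n + Σ_{i=1}^{n} μ₀(vᵢ, f_{n−i}) = 0` for all `n`. -/
theorem statement3
    {A0 A1 A2 B : Type*}
    [AddCommGroup A0] [AddCommGroup A1] [AddCommGroup A2] [AddCommGroup B]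
    [Module ℂ A0] [Module ℂ A1] [Module ℂ A2] [Module ℂ B]
    (d0 : A0 →ₗ[ℂ] A1) (d1 : A1 →ₗ[ℂ] A2)
    (hd : d1 ∘ₗ d0 = 0)
    (μ0 : B →ₗ[ℂ] A0 →ₗ[ℂ] A1) (μ1 : B →ₗ[ℂ] A1 →ₗ[ℂ] A2)
    (hi : ∀ (v : B) (f : A0), d1 (μ0 v f) + μ1 v (d0 f) = 0)
    (hii : ∀ (v w : B) (f : A0), μ1 v (μ0 w f) + μ1 w (μ0 v f) = 0)
    (f0 : A0) (hf0 : d0 f0 = 0)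
    (v1 : B) (hv1 : μ0 v1 f0 ∈ LinearMap.range d0)
    (htrans : ∀ y : A1, d1 y = 0 → μ1 v1 y ∈ LinearMap.range d1 →
      ∃ (s : A0) (w : B) (g : A0),
        d0 s = 0 ∧ y = μ0 w f0 + μ0 v1 s + d0 g) :
    ∃ (v : ℕ → B) (f : ℕ → A0),
      v 1 = v1 ∧ f 0 = f0 ∧
      ∀ n : ℕ, d0 (f n) + ∑ i ∈ Finset.Icc 1 n, μ0 (v i) (f (n - i)) = 0 := by
  have : IsAddTorsionFree A2 := .of_isTorsionFree ℂ A2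
  obtain ⟨g, hg⟩ := hv1
  let P (n : ℕ) (p : (ℕ → B) × (ℕ → A0)) : Prop :=
    p.1 1 = v1 ∧ p.2 0 = f0 ∧ ∀ k ≤ n + 1, deformationCoeff d0 μ0 p.1 p.2 k = 0
  have hbase : P 0 (fun _ ↦ v1, fun n ↦ if n = 0 then f0 else -g) := by
    refine ⟨rfl, rfl, fun k hk ↦ ?_⟩
    interval_cases k <;> simp [deformationCoeff, hf0, hg]
  have hstep : ∀ n (p : {p // P n p}), ∃ q : {q // P (n + 1) q},
      (∀ i ≤ n, q.1.1 i = p.1.1 i) ∧ ∀ i ≤ n, q.1.2 i = p.1.2 i := by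
    rintro n ⟨⟨v, f⟩, hv, hf, h⟩
    dsimp only at hv hf h
    obtain ⟨v', f', hv', hf', h'⟩ := exists_deformation_extension d0 d1 hd μ0 μ1 hi hii v f
      (by rwa [hv, hf]) (Nat.le_add_left 1 n) h
    exact ⟨⟨(v', f'), (hv' 1 (by omega)).trans hv, (hf' 0 (by omega)).trans hf, h'⟩,
      fun i hi ↦ hv' i (by omega), fun i hi ↦ hf' i (by omega)⟩
  choose next hnext using hstep
  let S : ∀ n, {p // P n p} := fun n ↦ Nat.rec ⟨_, hbase⟩ next n
  have hS : ∀ {i n : ℕ}, i ≤ n → (S i).1.1 i = (S n).1.1 i ∧ (S i).1.2 i = (S n).1.2 i := by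
    intro i n hin
    induction n, hin using Nat.le_induction with
    | base => exact ⟨rfl, rfl⟩
    | succ n hin ih =>
      exact ⟨ih.1.trans ((hnext n (S n)).1 i hin).symm, ih.2.trans ((hnext n (S n)).2 i hin).symm⟩
  refine ⟨fun i ↦ (S i).1.1 i, fun i ↦ (S i).1.2 i, (S 1).2.1, (S 0).2.2.1, fun n ↦ ?_⟩
  exact (deformationCoeff_congr d0 μ0 (fun i hi ↦ (hS hi).1) fun i hi ↦ (hS hi).2).trans
    ((S n).2.2.2 n (Nat.le_succ n))
end

section
/- Let B⁰, B¹, C⁰, C¹, C² be vector spaces over ℂ with linear maps ∂ : B⁰ → C⁰, ∂' : B¹ → C¹, ∂̄_B : B⁰ → B¹, ∂̄₀ : C⁰ → C¹, ∂̄₁ : C¹ → C², L_B : B⁰ → B¹, L₀ : C⁰ → C¹, L₁ : C¹ → C², satisfying: ∂̄₀ ∘ ∂ + ∂' ∘ ∂̄_B = 0; L₀ ∘ ∂ + ∂' ∘ L_B = 0; ∂̄₁ ∘ L₀ + L₁ ∘ ∂̄₀ = 0; and L₁ ∘ L₀ = 0. Assume the ∂∂̄-lemma condition: every θ ∈ C¹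 with ∂̄₁ θ = 0 and θ ∈ range(∂') lies in range(∂̄₀ ∘ ∂). Let f₀ ∈ C⁰ satisfy ∂̄₀ f₀ = 0 and L₀ f₀ ∈ range(∂̄₀ ∘ ∂). Then there exists a sequence (gᵢ)_{i ≥ 1} in B⁰ such that, setting fᵢ = ∂ gᵢ for i ≥ 1, one has ∂̄₀ fᵢ + L₀ f_{i−1} = 0 for every i ≥ 1. -/
/-- algebraic content of Lemma 4.1, via the ∂∂̄-lemma.
Given the commutation identities between `∂`, `∂̄` and `L`, the ∂∂̄-lemma
condition, and `f₀` with `∂̄₀ f₀ = 0` and `L₀ f₀ ∈ range (∂̄₀ ∘ ∂)`, there is a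
sequence `(gᵢ)_{i≥1}` in `B⁰` such that, setting `fᵢ = ∂ gᵢ` for `i ≥ 1`, one
has `∂̄₀ fᵢ + L₀ f_{i−1} = 0` for all `i ≥ 1`. -/
theorem statement4
    {B0 B1 C0 C1 C2 : Type*}
    [AddCommGroup B0] [AddCommGroup B1]
    [AddCommGroup C0] [AddCommGroup C1] [AddCommGroup C2]
    [Module ℂ B0] [Module ℂ B1] [Module ℂ C0] [Module ℂ C1] [Module ℂ C2]
    (del : B0 →ₗ[ℂ] C0) (del' : B1 →ₗ[ℂ] C1)
    (dbarB : B0 →ₗ[ℂ] B1) (dbar0 : C0 →ₗ[ℂ] C1) (dbar1 : C1 →ₗ[ℂ] C2)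
    (LB : B0 →ₗ[ℂ] B1) (L0 : C0 →ₗ[ℂ] C1) (L1 : C1 →ₗ[ℂ] C2)
    (h1 : dbar0 ∘ₗ del + del' ∘ₗ dbarB = 0)
    (h2 : L0 ∘ₗ del + del' ∘ₗ LB = 0)
    (h3 : dbar1 ∘ₗ L0 + L1 ∘ₗ dbar0 = 0)
    (h4 : L1 ∘ₗ L0 = 0)
    (hddbar : ∀ θ : C1, dbar1 θ = 0 → θ ∈ LinearMap.range del' →
      θ ∈ LinearMap.range (dbar0 ∘ₗ del))
    (f0 : C0) (hf0 : dbar0 f0 = 0)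
    (hL : L0 f0 ∈ LinearMap.range (dbar0 ∘ₗ del)) :
    ∃ g : ℕ → B0, ∀ i : ℕ, 1 ≤ i →
      dbar0 (del (g i)) + L0 (if i = 1 then f0 else del (g (i - 1))) = 0 := by
  have step : ∀ b : {b : B0 // L1 (dbar0 (del b)) = 0},
      ∃ b' : {b : B0 // L1 (dbar0 (del b)) = 0}, dbar0 (del b') + L0 (del b) = 0 := by
    rintro ⟨b, hb⟩
    have hclosed : dbar1 (L0 (del b)) = 0 := by
      simpa [hb] using LinearMap.congr_fun h3 (del b)
    have hexact : L0 (del b) ∈ LinearMap.range del' :=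
      ⟨-LB b, by simpa using (eq_neg_of_add_eq_zero_left (LinearMap.congr_fun h2 b)).symm⟩
    obtain ⟨c, hc⟩ := hddbar _ hclosed hexact
    have hc' : dbar0 (del c) = L0 (del b) := hc
    have hLL : L1 (L0 (del b)) = 0 := LinearMap.congr_fun h4 (del b)
    exact ⟨⟨-c, by simp [hc', hLL]⟩, by simp [hc']⟩
  choose next hnext using step
  obtain ⟨c, hc⟩ := hL
  have hc' : dbar0 (del c) = L0 f0 := hc
  have hLL : L1 (L0 f0) = 0 := LinearMap.congr_fun h4 f0
  let s : ℕ → {b : B0 // L1 (dbar0 (del b)) = 0} :=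
    Nat.rec ⟨-c, by simp [hc', hLL]⟩ fun _ b => next b
  refine ⟨fun i => (s (i - 1)).1, fun i hi => ?_⟩
  obtain _ | _ | n := i
  · omega
  · simp [s, hc']
  · simpa using hnext (s n)
end

section
/- Let A⁰, A¹, A² be vector spaces over ℂ, let d₀ : A⁰ → A¹ and d₁ : A¹ → A² be linear maps with d₁ ∘ d₀ = 0, and let L₀ : A⁰ → A¹ and L₁ : A¹ → A² be linear maps with d₁ ∘ L₀ + L₁ ∘ d₀ = 0 and L₁ ∘ L₀ = 0. Let H⁰ := ker(d₀), let Z := { y ∈ A¹ : d₁ y = 0 and L₁ y ∈ range(d₁) } (note range(d₀) ⊆ Z), and let H¹_ζ := Z / range(d₀). Assume H⁰ and H¹_ζ are finite-dimensional. Let W := { f₀ ∈ H⁰ : there exists a sequence (fᵢ)_{i ∈ ℕ} in A⁰ with f_0 = f₀ and d₀ f_n + L₀ f_{n−1} = 0 for every n ≥ 1 }. Then W is a ℂ-linear subspace of H⁰ and dim W ≥ dim H⁰ − dim H¹_ζ. -/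
/-- The dimension of `α T` plus that of `β (T ⊓ ker α)` is the dimension of the image of `T`
under `(α, β)`. -/
theorem finrank_map_add_finrank_map_inf_ker {K M U V : Type*} [Field K]
    [AddCommGroup M] [AddCommGroup U] [AddCommGroup V] [Module K M] [Module K U] [Module K V]
    (T : Submodule K M) (α : M →ₗ[K] U) (β : M →ₗ[K] V)
    [FiniteDimensional K (T.map α)] [FiniteDimensional K (T.map β)] :
    Module.finrank K (T.map α) + Module.finrank K ((T ⊓ LinearMap.ker α).map β) =
      Module.finrank K (T.map (α.prod β)) := by
  have hle : T.map (α.prod β) ≤ (T.map α).prod (T.map β) := by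
    rintro _ ⟨x, hx, rfl⟩
    exact ⟨⟨x, hx, rfl⟩, ⟨x, hx, rfl⟩⟩
  have : FiniteDimensional K ((T.map α).prod (T.map β)) :=
    Module.Finite.iff_fg.mpr
      (Submodule.FG.prod (Module.Finite.iff_fg.mp ‹_›) (Module.Finite.iff_fg.mp ‹_›))
  have : FiniteDimensional K (T.map (α.prod β)) := Submodule.finiteDimensional_of_le hle
  set P := T.map (α.prod β) with hP
  let p : P →ₗ[K] U := LinearMap.fst K U V ∘ₗ P.subtype
  let r : LinearMap.ker p →ₗ[K] V := LinearMap.snd K U V ∘ₗ P.subtype ∘ₗ (LinearMap.ker p).subtype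
  have hp : LinearMap.range p = T.map α := by
    rw [LinearMap.range_comp, Submodule.range_subtype, hP, ← Submodule.map_comp,
      LinearMap.fst_prod]
  have hinj : Function.Injective r := by
    rintro ⟨⟨x, hx⟩, hx'⟩ ⟨⟨y, hy⟩, hy'⟩ hxy
    have hxy' : x.1 = y.1 := Eq.trans (b := 0) hx' (Eq.symm hy')
    exact Subtype.ext (Subtype.ext (Prod.ext hxy' hxy))
  have hr : LinearMap.range r = (T ⊓ LinearMap.ker α).map β := by
    ext v
    constructor
    · rintro ⟨⟨⟨_, ⟨x, hx, rfl⟩⟩, hx'⟩, rfl⟩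
      exact ⟨x, ⟨hx, hx'⟩, rfl⟩
    · rintro ⟨x, ⟨hx, hx'⟩, rfl⟩
      exact ⟨⟨⟨_, ⟨x, hx, rfl⟩⟩, hx'⟩, rfl⟩
  rw [← LinearMap.finrank_range_add_finrank_ker p, hp, ← hr, LinearMap.finrank_range_of_inj hinj]

theorem finrank_map_add_finrank_map_inf_ker_comm {K M U V : Type*} [Field K]
    [AddCommGroup M] [AddCommGroup U] [AddCommGroup V] [Module K M] [Module K U] [Module K V]
    (T : Submodule K M) (α : M →ₗ[K] U) (β : M →ₗ[K] V)
    [FiniteDimensional K (T.map α)] [FiniteDimensional K (T.map β)] :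
    Module.finrank K (T.map α) + Module.finrank K ((T ⊓ LinearMap.ker α).map β) =
      Module.finrank K (T.map β) + Module.finrank K ((T ⊓ LinearMap.ker β).map α) := by
  rw [finrank_map_add_finrank_map_inf_ker, finrank_map_add_finrank_map_inf_ker]
  have h : T.map (β.prod α) =
      (T.map (α.prod β)).map (LinearEquiv.prodComm K U V : U × V →ₗ[K] V × U) := by
    rw [← Submodule.map_comp]
    rfl
  rw [h, LinearEquiv.finrank_map_eq]

section FormalSolution

variable {K A B C : Type*} [Field K] [AddCommGroup A] [AddCommGroup B] [AddCommGroup C]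
  [Module K A] [Module K B] [Module K C]

/-- The sequences solving `(d + t L) (∑ tⁱ fᵢ) = 0` modulo `tⁿ⁺¹`; only the terms of index at
most `n` are constrained. -/
def truncatedSolution (d L : A →ₗ[K] B) (n : ℕ) : Submodule K (ℕ → A) where
  carrier := {f | d (f 0) = 0 ∧ ∀ i < n, d (f (i + 1)) + L (f i) = 0}
  zero_mem' := by simp
  add_mem' := by
    rintro f g ⟨hf, hf'⟩ ⟨hg, hg'⟩
    refine ⟨by simp [hf, hg], fun i hi => ?_⟩
    have h := congrArg₂ (· + ·) (hf' i hi) (hg' i hi)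
    simp only [add_zero] at h
    rw [← h, Pi.add_apply, Pi.add_apply, map_add, map_add]
    abel
  smul_mem' := by
    rintro c f ⟨hf, hf'⟩
    exact ⟨by simp [hf], fun i hi => by simp [← smul_add, hf' i hi]⟩

/-- The space of leading terms of formal solutions of `(d + t L) (∑ tⁱ fᵢ) = 0`. -/
def formalSolutionLeading (d L : A →ₗ[K] B) : Submodule K A where
  carrier := {a | d a = 0 ∧ ∃ f : ℕ → A, f 0 = a ∧ ∀ n, 1 ≤ n → d (f n) + L (f (n - 1)) = 0}
  zero_mem' := ⟨map_zero d, 0, rfl, by simp⟩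
  add_mem' := by
    rintro _ _ ⟨ha, f, rfl, hf⟩ ⟨hb, g, rfl, hg⟩
    refine ⟨by simp [ha, hb], f + g, rfl, fun i hi => ?_⟩
    have h := congrArg₂ (· + ·) (hf i hi) (hg i hi)
    simp only [add_zero] at h
    rw [← h, Pi.add_apply, Pi.add_apply, map_add, map_add]
    abel
  smul_mem' := by
    rintro c _ ⟨ha, f, rfl, hf⟩
    exact ⟨by simp [ha], c • f, rfl, fun i hi => by simp [← smul_add, hf i hi]⟩

/-- The obstruction to extending a solution modulo `tⁿ⁺¹` by a further term. -/
def obstruction (d L : A →ₗ[K] B) (n : ℕ) : (ℕ → A) →ₗ[K] B ⧸ LinearMap.range d :=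
  (LinearMap.range d).mkQ ∘ₗ L ∘ₗ LinearMap.proj n

/-- The obstructions, at order `n`, of the truncated solutions with vanishing leading term. -/
def obstructionSpace (d L : A →ₗ[K] B) (n : ℕ) : Submodule K (B ⧸ LinearMap.range d) :=
  (truncatedSolution d L n ⊓ LinearMap.ker (LinearMap.proj 0)).map (obstruction d L n)

variable {d L : A →ₗ[K] B}

theorem exists_truncatedSolution_succ {n : ℕ} {f : ℕ → A} (hf : f ∈ truncatedSolution d L n)
    (h : obstruction d L n f = 0) :
    ∃ g ∈ truncatedSolution d L (n + 1), ∀ i ≤ n, g i = f i := by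
  obtain ⟨a, ha⟩ : L (f n) ∈ LinearMap.range d := (Submodule.Quotient.mk_eq_zero _).mp h
  have hg : ∀ i ≤ n, Function.update f (n + 1) (-a) i = f i := fun i hi =>
    Function.update_of_ne (by omega) _ _
  refine ⟨Function.update f (n + 1) (-a), ⟨?_, fun i hi => ?_⟩, hg⟩
  · rw [hg 0 n.zero_le]
    exact hf.1
  · rw [hg i (by omega)]
    obtain rfl | hi' := eq_or_ne i n
    · simp [ha]
    · rw [hg (i + 1) (by omega)]
      exact hf.2 i (by omega)

theorem map_obstruction_le_obstructionSpace_succ (n : ℕ) :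
    (truncatedSolution d L n).map (obstruction d L n) ≤ obstructionSpace d L (n + 1) := by
  rintro _ ⟨f, hf, rfl⟩
  let g : ℕ → A := fun i => Nat.casesOn i 0 f
  have hg : g 0 = 0 := rfl
  refine ⟨g, ⟨⟨map_zero d, fun i hi => ?_⟩, hg⟩, rfl⟩
  cases i with
  | zero => rw [hg, map_zero, add_zero]; exact hf.1
  | succ i => exact hf.2 i (by omega)

theorem monotone_obstructionSpace : Monotone (obstructionSpace d L) :=
  monotone_nat_of_le_succ fun n =>
    (Submodule.map_mono inf_le_left).trans (map_obstruction_le_obstructionSpace_succ n)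

theorem map_truncatedSolution_inf_ker_obstruction_le (n : ℕ) :
    (truncatedSolution d L n ⊓ LinearMap.ker (obstruction d L n)).map (LinearMap.proj 0) ≤
      (truncatedSolution d L (n + 1)).map (LinearMap.proj 0 : (ℕ → A) →ₗ[K] A) := by
  rintro _ ⟨f, ⟨hf, hf'⟩, rfl⟩
  obtain ⟨g, hg, hgf⟩ := exists_truncatedSolution_succ hf hf'
  exact ⟨g, hg, hgf 0 n.zero_le⟩

theorem map_proj_zero_truncatedSolution_le_ker (n : ℕ) :
    (truncatedSolution d L n).map (LinearMap.proj 0 : (ℕ → A) →ₗ[K] A) ≤ LinearMap.ker d := by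
  rintro _ ⟨f, hf, rfl⟩
  exact hf.1

theorem finrank_ker_le_finrank_map_add_finrank_obstructionSpace
    [FiniteDimensional K (LinearMap.ker d)]
    [∀ n, FiniteDimensional K (obstructionSpace d L n)] (n : ℕ) :
    Module.finrank K (LinearMap.ker d) ≤
      Module.finrank K ((truncatedSolution d L n).map (LinearMap.proj 0 : (ℕ → A) →ₗ[K] A)) +
        Module.finrank K (obstructionSpace d L n) := by
  have hW (n : ℕ) : FiniteDimensional K
      ((truncatedSolution d L n).map (LinearMap.proj 0 : (ℕ → A) →ₗ[K] A)) :=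
    Submodule.finiteDimensional_of_le (map_proj_zero_truncatedSolution_le_ker n)
  induction n with
  | zero =>
    refine (Submodule.finrank_mono ?_).trans (Nat.le_add_right _ _)
    exact fun a ha => ⟨fun _ => a, ⟨ha, by simp⟩, rfl⟩
  | succ n ih =>
    have : FiniteDimensional K ((truncatedSolution d L n).map (obstruction d L n)) :=
      Submodule.finiteDimensional_of_le (map_obstruction_le_obstructionSpace_succ n)
    have h := finrank_map_add_finrank_map_inf_ker_comm (truncatedSolution d L n)
      (LinearMap.proj 0) (obstruction d L n)
    have h₁ := Submodule.finrank_mono (map_obstruction_le_obstructionSpace_succ (d := d) (L := L) n)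
    have h₂ := Submodule.finrank_mono
      (map_truncatedSolution_inf_ker_obstruction_le (d := d) (L := L) n)
    rw [obstructionSpace] at ih
    omega

/-- Once the obstruction spaces are stationary from order `N` on, a solution modulo `tⁿ⁺¹` with
`n = N + k` can be extended by a further term after changing only its terms of index above `k`. -/
theorem exists_truncatedSolution_succ_of_obstructionSpace_le {N : ℕ}
    (hN : ∀ n, obstructionSpace d L n ≤ obstructionSpace d L N) (k : ℕ) {f : ℕ → A}
    (hf : f ∈ truncatedSolution d L (N + k)) :
    ∃ g ∈ truncatedSolution d L (N + (k + 1)), ∀ i ≤ k, g i = f i := by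
  obtain ⟨g, ⟨hg, hg0 : g 0 = 0⟩, hgf⟩ :=
    hN _ (map_obstruction_le_obstructionSpace_succ _ ⟨f, hf, rfl⟩)
  let s : ℕ → A := fun i => if i < k then 0 else g (i - k)
  have hs : ∀ i ≤ k, s i = 0 := fun i hi => by
    obtain rfl | hi := hi.eq_or_lt
    · simp [s, hg0]
    · simp [s, hi]
  have hs' (i : ℕ) : s (k + i) = g i := by simp [s]
  have hsT : s ∈ truncatedSolution d L (N + k) := by
    refine ⟨by rw [hs 0 k.zero_le, map_zero], fun i hi => ?_⟩
    obtain hik | hki := lt_or_ge i k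
    · rw [hs i hik.le, hs (i + 1) hik, map_zero, map_zero, add_zero]
    · obtain ⟨j, rfl⟩ := Nat.exists_eq_add_of_le hki
      rw [add_assoc, hs', hs']
      exact hg.2 j (by omega)
  have hobs : obstruction d L (N + k) (f - s) = 0 := by
    rw [map_sub, ← hgf, sub_eq_zero, add_comm N k]
    simp [obstruction, hs']
  obtain ⟨e, he, hef⟩ := exists_truncatedSolution_succ (sub_mem hf hsT) hobs
  exact ⟨e, he, fun i hi => by rw [hef i (by omega), Pi.sub_apply, hs i hi, sub_zero]⟩

theorem map_proj_zero_truncatedSolution_le_formalSolutionLeading {N : ℕ}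
    (hN : ∀ n, obstructionSpace d L n ≤ obstructionSpace d L N) :
    (truncatedSolution d L N).map (LinearMap.proj 0) ≤ formalSolutionLeading d L := by
  rintro _ ⟨f, hf, rfl⟩
  choose! next hnext hnext_eq using
    fun k f => exists_truncatedSolution_succ_of_obstructionSpace_le (f := f) hN k
  let F : ℕ → ℕ → A := fun k => Nat.rec f next k
  have hF (k : ℕ) : F k ∈ truncatedSolution d L (N + k) := by
    induction k with
    | zero => exact hf
    | succ k ih => exact hnext k (F k) ih
  refine ⟨hf.1, fun i => F i i, rfl, fun n hn => ?_⟩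
  obtain ⟨i, rfl⟩ := Nat.exists_eq_add_of_le' hn
  have h : F (i + 1) i = F i i := hnext_eq i (F i) (hF i) i le_rfl
  simpa only [Nat.add_sub_cancel, h] using (hF (i + 1)).2 i (by omega)

theorem finrank_ker_le_finrank_formalSolutionLeading_add [FiniteDimensional K (LinearMap.ker d)]
    (F : Submodule K (B ⧸ LinearMap.range d)) [FiniteDimensional K F]
    (hF : ∀ n, obstructionSpace d L n ≤ F) :
    Module.finrank K (LinearMap.ker d) ≤
      Module.finrank K (formalSolutionLeading d L) + Module.finrank K F := by
  have hfin (n : ℕ) : FiniteDimensional K (obstructionSpace d L n) :=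
    Submodule.finiteDimensional_of_le (hF n)
  have : FiniteDimensional K (formalSolutionLeading d L) :=
    Submodule.finiteDimensional_of_le (S₂ := LinearMap.ker d) fun a ha => ha.1
  obtain ⟨N, hN⟩ : ∃ N, ∀ n, obstructionSpace d L n ≤ obstructionSpace d L N := by
    have hrange : (Set.range fun n => Module.finrank K (obstructionSpace d L n)).Finite :=
      (Set.finite_Iic (Module.finrank K F)).subset <|
        Set.range_subset_iff.mpr fun n => Submodule.finrank_mono (hF n)
    obtain ⟨_, ⟨N, rfl⟩, hmax⟩ := hrange.exists_maximal (Set.range_nonempty _)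
    refine ⟨N, fun n => ?_⟩
    have hle := monotone_obstructionSpace (d := d) (L := L) (le_max_right n N)
    rw [Submodule.eq_of_le_of_finrank_le hle
      (hmax ⟨max n N, rfl⟩ (Submodule.finrank_mono hle))]
    exact monotone_obstructionSpace (le_max_left n N)
  have h₁ := finrank_ker_le_finrank_map_add_finrank_obstructionSpace (d := d) (L := L) N
  have h₂ := Submodule.finrank_mono (map_proj_zero_truncatedSolution_le_formalSolutionLeading hN)
  have h₃ := Submodule.finrank_mono (hF N)
  omega

theorem obstructionSpace_le_map_mkQ {d' L' : B →ₗ[K] C} (hdL : d' ∘ₗ L + L' ∘ₗ d = 0)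
    (hLL : L' ∘ₗ L = 0) (n : ℕ) :
    obstructionSpace d L n ≤
      (LinearMap.ker d' ⊓ (LinearMap.range d').comap L').map (LinearMap.range d).mkQ := by
  have hLL' (a : A) : L' (L a) = 0 := LinearMap.congr_fun hLL a
  have hdL' (a : A) : d' (L a) = -L' (d a) := eq_neg_of_add_eq_zero_left (LinearMap.congr_fun hdL a)
  rintro _ ⟨f, ⟨hf, -⟩, rfl⟩
  refine ⟨L (f n), ⟨?_, 0, by rw [map_zero, hLL']⟩, rfl⟩
  change d' (L (f n)) = 0
  cases n with
  | zero => rw [hdL', hf.1, map_zero, neg_zero]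
  | succ n =>
    rw [hdL', eq_neg_of_add_eq_zero_left (hf.2 n n.lt_succ_self), map_neg, hLL', neg_zero, neg_zero]

end FormalSolution


/-- algebraic content of Lemma 3.1: `dim W_ζ ≥ h⁰(E) − h¹(E)_ζ`.
With `H⁰ = ker d₀`, `Z = {y ∈ A¹ : d₁ y = 0, L₁ y ∈ range d₁}` and
`H¹_ζ = Z / range d₀`, the set `W` of `f₀ ∈ H⁰` admitting a formal linear
solution is a ℂ-linear subspace of `H⁰` with
`dim W ≥ dim H⁰ − dim H¹_ζ`. -/
theorem statement5
    {A0 A1 A2 : Type*}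
    [AddCommGroup A0] [AddCommGroup A1] [AddCommGroup A2]
    [Module ℂ A0] [Module ℂ A1] [Module ℂ A2]
    (d0 : A0 →ₗ[ℂ] A1) (d1 : A1 →ₗ[ℂ] A2)
    (L0 : A0 →ₗ[ℂ] A1) (L1 : A1 →ₗ[ℂ] A2)
    (hdd : d1 ∘ₗ d0 = 0)
    (hdL : d1 ∘ₗ L0 + L1 ∘ₗ d0 = 0)
    (hLL : L1 ∘ₗ L0 = 0)
    (hfin0 : FiniteDimensional ℂ (LinearMap.ker d0))
    (hfin1 : FiniteDimensional ℂ
      (↥(LinearMap.ker d1 ⊓ (LinearMap.range d1).comap L1) ⧸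
        ((LinearMap.range d0).comap
          (LinearMap.ker d1 ⊓ (LinearMap.range d1).comap L1).subtype))) :
    ∃ W : Submodule ℂ A0,
      ((W : Set A0) =
        {f0 : A0 | d0 f0 = 0 ∧
          ∃ f : ℕ → A0, f 0 = f0 ∧
            ∀ n : ℕ, 1 ≤ n → d0 (f n) + L0 (f (n - 1)) = 0}) ∧
      (Module.finrank ℂ (LinearMap.ker d0) : ℤ) -
          Module.finrank ℂ
            (↥(LinearMap.ker d1 ⊓ (LinearMap.range d1).comap L1) ⧸
              ((LinearMap.range d0).comap
                (LinearMap.ker d1 ⊓ (LinearMap.range d1).comap L1).subtype)) ≤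
        (Module.finrank ℂ W : ℤ) := by
  have hrange : LinearMap.range (Submodule.mapQ _ (LinearMap.range d0)
      (LinearMap.ker d1 ⊓ (LinearMap.range d1).comap L1).subtype le_rfl) =
      (LinearMap.ker d1 ⊓ (LinearMap.range d1).comap L1).map (LinearMap.range d0).mkQ := by
    rw [Submodule.range_mapQ, Submodule.range_subtype]
  have hF : FiniteDimensional ℂ
      ((LinearMap.ker d1 ⊓ (LinearMap.range d1).comap L1).map (LinearMap.range d0).mkQ) := by
    rw [← hrange]
    infer_instance
  have hle := hrange ▸ LinearMap.finrank_range_le (Submodule.mapQ _ (LinearMap.range d0)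
    (LinearMap.ker d1 ⊓ (LinearMap.range d1).comap L1).subtype le_rfl)
  have h := finrank_ker_le_finrank_formalSolutionLeading_add _
    (obstructionSpace_le_map_mkQ hdL hLL)
  exact ⟨formalSolutionLeading d0 L0, rfl, by omega⟩
end
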